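/- There is no normal subgroup N of the automorphism group MulAut H such that N has index 3 in MulAut H and N contains every inner automorphism of H (i.e. contains the image of the conjugation homomorphism H → MulAut H). -/

import Mathlib

open Matrix

/-- The set of upper unitriangular matrices inside `GL (Fin 3) (ZMod 3)`:
entries `1` on the diagonal and `0` below the diagonal. -/
def UTcarrier : Set (GL (Fin 3) (ZMod 3)) :=
  {A | (∀ i j : Fin 3, j < i → (A : Matrix (Fin 3) (Fin 3) (ZMod 3)) i j = 0) ∧
       (∀ i : Fin 3, (A : Matrix (Fin 3) (Fin 3) (ZMod 3)) i i = 1)}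

lemma UT_one_mem : (1 : GL (Fin 3) (ZMod 3)) ∈ UTcarrier := by
  constructor
  · intro i j hij
    exact Matrix.one_apply_ne (ne_of_gt hij)
  · intro i
    simp [Matrix.one_apply]

lemma UT_mul_mem {a b : GL (Fin 3) (ZMod 3)} (ha : a ∈ UTcarrier) (hb : b ∈ UTcarrier) :
    a * b ∈ UTcarrier := by
  obtain ⟨ha1, ha2⟩ := ha
  obtain ⟨hb1, hb2⟩ := hb
  have a10 := ha1 1 0 (by decide)
  have a20 := ha1 2 0 (by decide)
  have a21 := ha1 2 1 (by decide)
  have b10 := hb1 1 0 (by decide)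
  have b20 := hb1 2 0 (by decide)
  have b21 := hb1 2 1 (by decide)
  have a00 := ha2 0; have a11 := ha2 1; have a22 := ha2 2
  have b00 := hb2 0; have b11 := hb2 1; have b22 := hb2 2
  have hval : ((a * b : GL (Fin 3) (ZMod 3)) : Matrix (Fin 3) (Fin 3) (ZMod 3))
      = (a : Matrix (Fin 3) (Fin 3) (ZMod 3)) * (b : Matrix (Fin 3) (Fin 3) (ZMod 3)) :=
    Units.val_mul a b
  constructor
  · intro i j hij
    rw [hval, Matrix.mul_apply, Fin.sum_univ_three]
    fin_cases i <;> fin_cases j <;> simp_all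
  · intro i
    rw [hval, Matrix.mul_apply, Fin.sum_univ_three]
    fin_cases i <;> simp_all

lemma UT_inv_mem {x : GL (Fin 3) (ZMod 3)} (hx : x ∈ UTcarrier) : x⁻¹ ∈ UTcarrier := by
  have hpow : ∀ n : ℕ, x ^ n ∈ UTcarrier := by
    intro n
    induction n with
    | zero => simpa using UT_one_mem
    | succ n ih => rw [pow_succ]; exact UT_mul_mem ih hx
  have hmul : x * x ^ (orderOf x - 1) = 1 := by
    rw [← pow_succ', Nat.sub_add_cancel (Nat.one_le_iff_ne_zero.mpr (orderOf_pos x).ne')]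
    exact pow_orderOf_eq_one x
  have key : x⁻¹ = x ^ (orderOf x - 1) := inv_eq_of_mul_eq_one_right hmul
  rw [key]
  exact hpow _

/-- `H`: the group of upper unitriangular `3 × 3` matrices over `ZMod 3`, i.e. the
extraspecial group `3₊^{1+2}` of order `27` and exponent `3`. -/
def H : Subgroup (GL (Fin 3) (ZMod 3)) where
  carrier := UTcarrier
  one_mem' := UT_one_mem
  mul_mem' := UT_mul_mem
  inv_mem' := UT_inv_mem

/-- Upper unitriangular `3 × 3` matrices over `ZMod 3` in coordinates: `⟨x, y, z⟩` stands for
the matrix with first row `1, x, z` and second row `0, 1, y`. -/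
@[ext]
structure Heis where
  x : ZMod 3
  y : ZMod 3
  z : ZMod 3

namespace Heis

instance : Mul Heis := ⟨fun p q => ⟨p.x + q.x, p.y + q.y, p.z + q.z + p.x * q.y⟩⟩
instance : One Heis := ⟨⟨0, 0, 0⟩⟩
instance : Inv Heis := ⟨fun p => ⟨-p.x, -p.y, -p.z + p.x * p.y⟩⟩

@[simp] lemma mul_x (p q : Heis) : (p * q).x = p.x + q.x := rfl
@[simp] lemma mul_y (p q : Heis) : (p * q).y = p.y + q.y := rfl
@[simp] lemma mul_z (p q : Heis) : (p * q).z = p.z + q.z + p.x * q.y := rfl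
@[simp] lemma one_x : (1 : Heis).x = 0 := rfl
@[simp] lemma one_y : (1 : Heis).y = 0 := rfl
@[simp] lemma one_z : (1 : Heis).z = 0 := rfl
@[simp] lemma inv_x (p : Heis) : p⁻¹.x = -p.x := rfl
@[simp] lemma inv_y (p : Heis) : p⁻¹.y = -p.y := rfl
@[simp] lemma inv_z (p : Heis) : p⁻¹.z = -p.z + p.x * p.y := rfl

instance : Group Heis :=
  Group.ofLeftAxioms
    (fun p q r => by ext <;> simp <;> ring)
    (fun p => by ext <;> simp)
    (fun p => by ext <;> simp)

/-- The coordinate description of `H`. -/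
noncomputable def equivH : Heis ≃* ↥H where
  toFun p := ⟨GeneralLinearGroup.mkOfDetNeZero !![1, p.x, p.z; 0, 1, p.y; 0, 0, 1]
      (by simp [det_fin_three]), by
    constructor
    · intro i j hij
      fin_cases i <;> fin_cases j <;>
        first | exact absurd hij (by decide) | simp [GeneralLinearGroup.mkOfDetNeZero]
    · intro i
      fin_cases i <;> simp [GeneralLinearGroup.mkOfDetNeZero]⟩
  invFun A := ⟨A.1 0 1, A.1 1 2, A.1 0 2⟩
  left_inv p := by ext <;> simp [GeneralLinearGroup.mkOfDetNeZero]
  right_inv A := by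
    obtain ⟨A, hlow, hdiag⟩ := A
    ext i j
    have h10 := hlow 1 0 (by decide)
    have h20 := hlow 2 0 (by decide)
    have h21 := hlow 2 1 (by decide)
    have h00 := hdiag 0
    have h11 := hdiag 1
    have h22 := hdiag 2
    fin_cases i <;> fin_cases j <;> simp_all [GeneralLinearGroup.mkOfDetNeZero]
  map_mul' p q := by
    ext i j
    fin_cases i <;> fin_cases j <;>
      simp [GeneralLinearGroup.mkOfDetNeZero, Matrix.mul_apply, Fin.sum_univ_three] <;> ring

/-- The automorphism exchanging the two standard generators. -/
def swap : MulAut Heis where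
  toFun p := ⟨p.y, p.x, p.x * p.y - p.z⟩
  invFun p := ⟨p.y, p.x, p.x * p.y - p.z⟩
  left_inv p := by ext <;> simp; ring
  right_inv p := by ext <;> simp; ring
  map_mul' p q := by ext <;> simp; ring

/-- The involution acting on the abelianization as the reflection
`(x, y) ↦ (-x, y - n * x)`. -/
def reflection (n : ZMod 3) : MulAut Heis where
  toFun p := ⟨-p.x, p.y - n * p.x, -p.z - n * p.x ^ 2⟩
  invFun p := ⟨-p.x, p.y - n * p.x, -p.z - n * p.x ^ 2⟩
  left_inv p := by ext <;> simp
  right_inv p := by ext <;> simp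
  map_mul' p q := by
    have h3 : (3 : ZMod 3) = 0 := rfl
    ext
    · simp; ring
    · simp; ring
    · simp only [mul_x, mul_z]
      linear_combination (-n * p.x * q.x) * h3

lemma swap_apply (p : Heis) : swap p = ⟨p.y, p.x, p.x * p.y - p.z⟩ := rfl

lemma reflection_apply (n : ZMod 3) (p : Heis) :
    reflection n p = ⟨-p.x, p.y - n * p.x, -p.z - n * p.x ^ 2⟩ := rfl

lemma swap_sq : swap ^ 2 = 1 := by
  ext p : 1
  exact swap.left_inv p

lemma reflection_sq (n : ZMod 3) : reflection n ^ 2 = 1 := by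
  ext p : 1
  exact (reflection n).left_inv p

lemma eq_mul_pow (p : Heis) :
    p = (⟨0, 1, 0⟩ : Heis) ^ p.y.val * ⟨1, 0, 0⟩ ^ p.x.val *
      (⟨1, 0, 0⟩ * ⟨0, 1, 0⟩ * ⟨1, 0, 0⟩⁻¹ * ⟨0, 1, 0⟩⁻¹) ^ p.z.val := by
  obtain ⟨x, y, z⟩ := p
  fin_cases x <;> fin_cases y <;> fin_cases z <;> rfl

lemma mulAut_ext {φ ψ : MulAut Heis} (hx : φ ⟨1, 0, 0⟩ = ψ ⟨1, 0, 0⟩)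
    (hy : φ ⟨0, 1, 0⟩ = ψ ⟨0, 1, 0⟩) : φ = ψ := by
  ext p : 1
  rw [eq_mul_pow p]
  simp only [map_mul, map_pow, map_inv, hx, hy]

lemma commute_of_x_eq_zero_of_y_eq_zero {p : Heis} (hx : p.x = 0) (hy : p.y = 0) (q : Heis) :
    p * q = q * p := by
  ext <;> simp [hx, hy, add_comm]

lemma exists_mem_apply_eq {K : Subgroup (MulAut Heis)}
    (hinv : ∀ g : MulAut Heis, g ^ 2 = 1 → g ∈ K) (hconj : ∀ p : Heis, MulAut.conj p ∈ K)
    {p : Heis} (hp : ¬ (p.x = 0 ∧ p.y = 0)) :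
    ∃ g ∈ K, g p = ⟨1, 0, 0⟩ := by
  have hs := hinv _ swap_sq
  have hr n := hinv _ (reflection_sq n)
  have of_one (z : ZMod 3) : ∃ g ∈ K, g ⟨1, 0, z⟩ = ⟨1, 0, 0⟩ :=
    ⟨_, hconj ⟨0, z, 0⟩, by ext <;> simp⟩
  have of_two (z : ZMod 3) : ∃ g ∈ K, g ⟨-1, 0, z⟩ = ⟨1, 0, 0⟩ := by
    obtain ⟨g, hg, h⟩ := of_one (-z)
    exact ⟨g * reflection 0, mul_mem hg (hr 0), by simpa [reflection_apply] using h⟩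
  have of_x (q : Heis) (hq : q.x ≠ 0) : ∃ g ∈ K, g q = ⟨1, 0, 0⟩ := by
    obtain ⟨x, y, z⟩ := q
    have hx : x = 1 ∨ x = -1 := by
      replace hq : x ≠ 0 := hq
      decide +revert
    obtain rfl | rfl := hx
    · obtain ⟨g, hg, h⟩ := of_two (-z - y)
      exact ⟨g * reflection y, mul_mem hg (hr y), by simpa [reflection_apply] using h⟩
    · obtain ⟨g, hg, h⟩ := of_one (-z + y)
      exact ⟨g * reflection (-y), mul_mem hg (hr _), by simpa [reflection_apply] using h⟩
  by_cases hx : p.x = 0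
  · obtain ⟨g, hg, h⟩ := of_x (swap p) fun hy => hp ⟨hx, hy⟩
    exact ⟨g * swap, mul_mem hg hs, h⟩
  · exact of_x p hx

lemma exists_mem_fix_apply_eq {K : Subgroup (MulAut Heis)}
    (hinv : ∀ g : MulAut Heis, g ^ 2 = 1 → g ∈ K) (hconj : ∀ p : Heis, MulAut.conj p ∈ K)
    {p : Heis} (hp : p.y ≠ 0) :
    ∃ g ∈ K, g ⟨1, 0, 0⟩ = ⟨1, 0, 0⟩ ∧ g p = ⟨0, 1, 0⟩ := by
  have hs := hinv _ swap_sq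
  have ht n : swap * reflection n * swap ∈ K :=
    mul_mem (mul_mem hs (hinv _ (reflection_sq n))) hs
  have of_one (z : ZMod 3) : ∃ g ∈ K, g ⟨1, 0, 0⟩ = ⟨1, 0, 0⟩ ∧ g ⟨0, 1, z⟩ = ⟨0, 1, 0⟩ :=
    ⟨_, hconj ⟨-z, 0, 0⟩, by ext <;> simp, by ext <;> simp⟩
  have of_two (z : ZMod 3) : ∃ g ∈ K, g ⟨1, 0, 0⟩ = ⟨1, 0, 0⟩ ∧ g ⟨0, -1, z⟩ = ⟨0, 1, 0⟩ := by
    obtain ⟨g, hg, h1, h⟩ := of_one (-z)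
    exact ⟨g * (swap * reflection 0 * swap), mul_mem hg (ht 0),
      by simpa [reflection_apply, swap_apply] using h1,
      by simpa [reflection_apply, swap_apply] using h⟩
  obtain ⟨x, y, z⟩ := p
  have hy : y = 1 ∨ y = -1 := by
    replace hp : y ≠ 0 := hp
    decide +revert
  obtain rfl | rfl := hy
  · obtain ⟨g, hg, h1, h⟩ := of_two ((swap * reflection x * swap) ⟨x, 1, z⟩).z
    refine ⟨g * (swap * reflection x * swap), mul_mem hg (ht x),
      by simpa [reflection_apply, swap_apply] using h1, ?_⟩
    simpa [reflection_apply, swap_apply] using h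
  · obtain ⟨g, hg, h1, h⟩ := of_one ((swap * reflection (-x) * swap) ⟨x, -1, z⟩).z
    refine ⟨g * (swap * reflection (-x) * swap), mul_mem hg (ht _),
      by simpa [reflection_apply, swap_apply] using h1, ?_⟩
    simpa [reflection_apply, swap_apply] using h

/-- `MulAut Heis` is generated by its involutions and inner automorphisms. -/
theorem eq_top_of_involutions_of_conj {K : Subgroup (MulAut Heis)}
    (hinv : ∀ g : MulAut Heis, g ^ 2 = 1 → g ∈ K) (hconj : ∀ p : Heis, MulAut.conj p ∈ K) :
    K = ⊤ := by
  refine eq_top_iff.2 fun φ _ => ?_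
  have hne (ψ : MulAut Heis) : ψ ⟨1, 0, 0⟩ * ψ ⟨0, 1, 0⟩ ≠ ψ ⟨0, 1, 0⟩ * ψ ⟨1, 0, 0⟩ := by
    rw [← map_mul, ← map_mul]
    intro h
    simpa using congrArg Heis.z (ψ.injective h)
  obtain ⟨g, hg, hgx⟩ := exists_mem_apply_eq hinv hconj (p := φ ⟨1, 0, 0⟩)
    fun h => hne φ (commute_of_x_eq_zero_of_y_eq_zero h.1 h.2 _)
  obtain ⟨k, hk, hkx, hky⟩ := exists_mem_fix_apply_eq hinv hconj (p := g (φ ⟨0, 1, 0⟩)) <| by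
    intro h
    apply hne (g * φ)
    simp only [MulAut.mul_apply, hgx]
    ext <;> simp [h, add_comm]
  have hone : k * g * φ = 1 := mulAut_ext (by simp [hgx, hkx]) (by simp [hky])
  rw [← K.mul_mem_cancel_left (mul_mem hk hg), hone]
  exact one_mem K

end Heis

theorem no_normal_index_three_above_inn :
    ¬ ∃ N : Subgroup (MulAut ↥H), N.Normal ∧ N.index = 3 ∧
        (MulAut.conj : ↥H →* MulAut ↥H).range ≤ N := by
  rintro ⟨N, hN, hindex, hinn⟩
  let F := MulAut.congr Heis.equivH
  have htop : N.comap F.toMonoidHom = ⊤ := by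
    apply Heis.eq_top_of_involutions_of_conj
    · intro g hg
      have h := N.pow_index_mem (F g)
      rwa [hindex, ← map_pow, pow_succ, hg, one_mul] at h
    · intro p
      refine hinn ⟨Heis.equivH p, ?_⟩
      ext q : 1
      simp [F, MulAut.congr]
  have hindex' := N.index_comap_of_surjective (f := F.toMonoidHom) F.surjective
  rw [htop, Subgroup.index_top, hindex] at hindex'
  omega
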